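/- If an RML^∃ formula φ is satisfiable, then there exists a complete accepting tableau branch for φ (i.e., a complete accepting branch starting from the initial prefixed formula (1,1) φ). -/

import Mathlib

/-- RML^∃ formulas: p | ¬p | φ∧φ | φ∨φ | ◇φ | □φ | ∃_r φ -/
inductive RML : Type where
  | pos : ℕ → RML
  | neg : ℕ → RML
  | and : RML → RML → RML
  | or  : RML → RML → RML
  | dia : RML → RML
  | box : RML → RML
  | ex  : RML → RML

/-- A Kripke model over a state type `W`. -/
structure Kripke (W : Type) where
  R : W → W → Prop
  V : W → Set ℕ

/-- `ρ` is a refinement mapping from `M` to `M'`: a non-empty relation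
satisfying the atom and back conditions. -/
def RefinementMapping {W W' : Type} (M : Kripke W) (M' : Kripke W')
    (ρ : W → W' → Prop) : Prop :=
  (∃ s s', ρ s s') ∧
  (∀ s s', ρ s s' → M.V s = M'.V s') ∧
  (∀ s s' t', ρ s s' → M'.R s' t' → ∃ t, M.R s t ∧ ρ t t')

/-- `(M', s')` is a refinement of `(M, s)`. -/
def RefinementOf {W W' : Type} (M' : Kripke W') (s' : W')
    (M : Kripke W) (s : W) : Prop :=
  ∃ ρ, RefinementMapping M M' ρ ∧ ρ s s'

/-- Semantics of RML^∃ formulas. -/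
def Sat {W : Type} (M : Kripke W) : W → RML → Prop
  | s, RML.pos p => p ∈ M.V s
  | s, RML.neg p => p ∉ M.V s
  | s, RML.and ψ₁ ψ₂ => Sat M s ψ₁ ∧ Sat M s ψ₂
  | s, RML.or ψ₁ ψ₂ => Sat M s ψ₁ ∨ Sat M s ψ₂
  | s, RML.dia ψ => ∃ t, M.R s t ∧ Sat M t ψ
  | s, RML.box ψ => ∀ t, M.R s t → Sat M t ψ
  | s, RML.ex ψ => ∃ (W' : Type) (M' : Kripke W') (s' : W'),
      RefinementOf M' s' M s ∧ Sat M' s' ψ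

def Satisfiable (φ : RML) : Prop :=
  ∃ (W : Type) (M : Kripke W) (s : W), Sat M s φ

/-- Prefixed formulas `(μ, σ) ψ`: a model prefix, a state prefix, a formula. -/
abbrev PrefixedFormula : Type := List ℕ × List ℕ × RML

def IsLiteral : RML → Prop
  | RML.pos _ => True
  | RML.neg _ => True
  | _ => False

/-- `Branch φ b` holds when `b` is obtained from `{(1,1) φ}` by repeatedly
applying the tableau rules. -/
inductive Branch (φ : RML) : Set PrefixedFormula → Prop
  | init : Branch φ {([1], [1], φ)}
  | andRule {b μ σ ψ₁ ψ₂} : Branch φ b → (μ, σ, RML.and ψ₁ ψ₂) ∈ b →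
      Branch φ (insert (μ, σ, ψ₁) (insert (μ, σ, ψ₂) b))
  | orLeft {b μ σ ψ₁ ψ₂} : Branch φ b → (μ, σ, RML.or ψ₁ ψ₂) ∈ b →
      Branch φ (insert (μ, σ, ψ₁) b)
  | orRight {b μ σ ψ₁ ψ₂} : Branch φ b → (μ, σ, RML.or ψ₁ ψ₂) ∈ b →
      Branch φ (insert (μ, σ, ψ₂) b)
  | litRule {b μ ν σ l} : Branch φ b → (μ ++ ν, σ, l) ∈ b → IsLiteral l →
      μ ≠ [] → ν ≠ [] → Branch φ (insert (μ, σ, l) b)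
  | diaRule {b μ σ ψ} (i : ℕ) : Branch φ b → (μ, σ, RML.dia ψ) ∈ b →
      (∀ μ' χ, (μ', σ ++ [i], χ) ∉ b) →
      Branch φ (insert (μ, σ ++ [i], ψ) b)
  | exRule {b μ σ ψ} (m : ℕ) : Branch φ b → (μ, σ, RML.ex ψ) ∈ b →
      (∀ σ' χ, (μ ++ [m], σ', χ) ∉ b) →
      Branch φ (insert (μ ++ [m], σ, ψ) b)
  | boxRule {b μ ν σ ψ i χ} : Branch φ b → (μ, σ, RML.box ψ) ∈ b →
      (μ ++ ν, σ ++ [i], χ) ∈ b →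
      Branch φ (insert (μ, σ ++ [i], ψ) b)

/-- A branch is complete when every applicable rule has been applied
exhaustively. -/
def Complete (b : Set PrefixedFormula) : Prop :=
  (∀ μ σ ψ₁ ψ₂, (μ, σ, RML.and ψ₁ ψ₂) ∈ b → (μ, σ, ψ₁) ∈ b ∧ (μ, σ, ψ₂) ∈ b) ∧
  (∀ μ σ ψ₁ ψ₂, (μ, σ, RML.or ψ₁ ψ₂) ∈ b → (μ, σ, ψ₁) ∈ b ∨ (μ, σ, ψ₂) ∈ b) ∧
  (∀ μ ν σ l, IsLiteral l → μ ≠ [] → ν ≠ [] → (μ ++ ν, σ, l) ∈ b → (μ, σ, l) ∈ b) ∧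
  (∀ μ σ ψ, (μ, σ, RML.dia ψ) ∈ b → ∃ i, (μ, σ ++ [i], ψ) ∈ b) ∧
  (∀ μ σ ψ, (μ, σ, RML.ex ψ) ∈ b → ∃ m, (μ ++ [m], σ, ψ) ∈ b) ∧
  (∀ μ ν σ i ψ χ, (μ, σ, RML.box ψ) ∈ b → (μ ++ ν, σ ++ [i], χ) ∈ b →
      (μ, σ ++ [i], ψ) ∈ b)

/-- A complete branch is accepting if it contains no clash. -/
def Accepting (b : Set PrefixedFormula) : Prop :=
  ¬ ∃ μ σ p, (μ, σ, RML.pos p) ∈ b ∧ (μ, σ, RML.neg p) ∈ b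

/-- A Kripke model together with a distinguished state. -/
structure PointedModel : Type 1 where
  {W : Type}
  M : Kripke W
  s : W

namespace PointedModel

/-- Truth of a formula at the distinguished state. -/
def Holds (P : PointedModel) (ψ : RML) : Prop := Sat P.M P.s ψ

/-- `Step P Q` when `Q` is the same model as `P`, pointed at a successor state. -/
inductive Step : PointedModel → PointedModel → Prop
  | mk {W : Type} (M : Kripke W) {s t : W} : M.R s t → Step ⟨M, s⟩ ⟨M, t⟩

/-- `P.Refines Q` when `Q` is a refinement of `P`. -/
def Refines (P Q : PointedModel) : Prop := RefinementOf Q.M Q.s P.M P.s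

theorem Refines.back {P Q Q' : PointedModel} (h : P.Refines Q) (hs : Q.Step Q') :
    ∃ P' : PointedModel, P.Step P' ∧ P'.Refines Q' := by
  obtain ⟨M, s⟩ := P
  cases hs with
  | mk N hR =>
    obtain ⟨ρ, ⟨hne, hat, hb⟩, hρ⟩ := h
    obtain ⟨t, hst, htt⟩ := hb _ _ _ hρ hR
    exact ⟨⟨M, t⟩, .mk M hst, ρ, ⟨hne, hat, hb⟩, htt⟩

theorem Refines.literal {P Q : PointedModel} (h : P.Refines Q) {l : RML} (hl : IsLiteral l)
    (hQ : Q.Holds l) : P.Holds l := by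
  obtain ⟨ρ, ⟨-, hat, -⟩, hρ⟩ := h
  have hV := hat _ _ hρ
  cases l <;> simp_all [IsLiteral, Holds, Sat]

theorem Step.box {P Q : PointedModel} (h : P.Step Q) {ψ : RML} (hP : P.Holds (.box ψ)) :
    Q.Holds ψ := by
  cases h with
  | mk M hR => exact hP _ hR

theorem Holds.dia {P : PointedModel} {ψ : RML} (h : P.Holds (.dia ψ)) :
    ∃ Q : PointedModel, P.Step Q ∧ Q.Holds ψ := by
  obtain ⟨M, s⟩ := P
  obtain ⟨t, hR, ht⟩ := h
  exact ⟨⟨M, t⟩, .mk M hR, ht⟩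

theorem Holds.ex {P : PointedModel} {ψ : RML} (h : P.Holds (.ex ψ)) :
    ∃ Q : PointedModel, P.Refines Q ∧ Q.Holds ψ := by
  obtain ⟨W', M', s', hr, hs⟩ := h
  exact ⟨⟨M', s'⟩, hr, hs⟩

/-- A step at the end of a chain of refinements lifts to the whole chain. -/
theorem exists_lift_step (g : List ℕ → PointedModel) (μ : List ℕ) (Q : PointedModel)
    (hg : ∀ κ m, κ ≠ [] → κ ++ [m] <+: μ → (g κ).Refines (g (κ ++ [m])))
    (hQ : (g μ).Step Q) :
    ∃ h : List ℕ → PointedModel, h μ = Q ∧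
      (∀ κ, κ ≠ [] → κ <+: μ → (g κ).Step (h κ)) ∧
      (∀ κ m, κ ≠ [] → κ ++ [m] <+: μ → (h κ).Refines (h (κ ++ [m]))) := by
  induction μ using List.reverseRecOn generalizing Q with
  | nil =>
    refine ⟨fun _ => Q, rfl, fun κ hκ hp => ?_, fun κ m _ hp => ?_⟩
    · exact absurd (List.prefix_nil.mp hp) hκ
    · simp at hp
  | append_singleton μ n ih =>
    by_cases hμ : μ = []
    · subst hμ
      refine ⟨fun _ => Q, rfl, fun κ hκ hp => ?_, fun κ m hκ hp => ?_⟩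
      · rcases List.prefix_concat_iff.mp hp with rfl | hp
        · exact hQ
        · exact absurd (List.prefix_nil.mp hp) hκ
      · rcases List.prefix_concat_iff.mp hp with h | h
        · exact absurd (List.append_inj_left' h rfl) hκ
        · simp at h
    · obtain ⟨P, hP, hPQ⟩ := (hg μ n hμ (List.prefix_refl _)).back hQ
      obtain ⟨h, hh, hstep, href⟩ :=
        ih P (fun κ m hκ hp => hg κ m hκ (hp.trans (List.prefix_append _ _))) hP
      refine ⟨Function.update h (μ ++ [n]) Q, by simp, fun κ hκ hp => ?_, fun κ m hκ hp => ?_⟩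
      · rcases List.prefix_concat_iff.mp hp with rfl | hp
        · simpa using hQ
        · rw [Function.update_of_ne]
          · exact hstep κ hκ hp
          · rintro rfl
            simpa using hp.length_le
      · have hlen := hp.length_le
        rw [Function.update_of_ne (a := κ)]
        · rcases List.prefix_concat_iff.mp hp with h' | h'
          · obtain rfl := List.append_inj_left' h' rfl
            rw [h', Function.update_self, hh]
            exact hPQ
          · rw [Function.update_of_ne]
            · exact href κ m hκ h'
            · intro h''
              rw [h''] at h'
              simpa using h'.length_le
        · rintro rfl
          simp at hlen

end PointedModel

/-- The state `σ` is relevant to the model `μ`: some formula sits at `σ` in an extension of `μ`. -/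
def Occurs (b : Set PrefixedFormula) (μ σ : List ℕ) : Prop :=
  μ ≠ [] ∧ ∃ κ χ, μ <+: κ ∧ (κ, σ, χ) ∈ b

theorem Occurs.insert_iff {b : Set PrefixedFormula} {μ σ : List ℕ} {ψ : RML} {κ τ : List ℕ} :
    Occurs (insert (μ, σ, ψ) b) κ τ ↔ (κ ≠ [] ∧ κ <+: μ ∧ τ = σ) ∨ Occurs b κ τ := by
  constructor
  · rintro ⟨hκ, κ', χ, hp, h | h⟩
    · simp only [Prod.mk.injEq] at h
      obtain ⟨rfl, rfl, rfl⟩ := h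
      exact .inl ⟨hκ, hp, rfl⟩
    · exact .inr ⟨hκ, κ', χ, hp, h⟩
  · rintro (⟨hκ, hp, rfl⟩ | ⟨hκ, κ', χ, hp, h⟩)
    · exact ⟨hκ, μ, ψ, hp, .inl rfl⟩
    · exact ⟨hκ, κ', χ, hp, .inr h⟩

theorem Occurs.of_isPrefix {b : Set PrefixedFormula} {μ κ σ : List ℕ} (h : Occurs b μ σ)
    (hκ : κ ≠ []) (hp : κ <+: μ) : Occurs b κ σ := by
  obtain ⟨-, μ', χ, hp', hm⟩ := h
  exact ⟨hκ, μ', χ, hp.trans hp', hm⟩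

theorem Occurs.insert_old {b : Set PrefixedFormula} {μ σ : List ℕ} {ψ : RML}
    (ho : Occurs b μ σ) {κ τ : List ℕ} (h : Occurs (insert (μ, σ, ψ) b) κ τ) : Occurs b κ τ := by
  rcases Occurs.insert_iff.mp h with ⟨hκ, hp, rfl⟩ | h
  · exact ho.of_isPrefix hκ hp
  · exact h

/-- `f` interprets the prefixes of `b` by pointed models so that all formulas of `b` hold. -/
structure Interprets (f : List ℕ → List ℕ → PointedModel) (b : Set PrefixedFormula) : Prop where
  ne_nil : ∀ {μ σ ψ}, (μ, σ, ψ) ∈ b → μ ≠ []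
  holds : ∀ {μ σ ψ}, (μ, σ, ψ) ∈ b → (f μ σ).Holds ψ
  refines : ∀ {μ m σ}, μ ≠ [] → Occurs b (μ ++ [m]) σ → (f μ σ).Refines (f (μ ++ [m]) σ)
  step : ∀ {μ σ i}, Occurs b μ σ → Occurs b μ (σ ++ [i]) → (f μ σ).Step (f μ (σ ++ [i]))

theorem Interprets.occurs {f : List ℕ → List ℕ → PointedModel} {b : Set PrefixedFormula}
    (h : Interprets f b) {μ σ : List ℕ} {ψ : RML} (hm : (μ, σ, ψ) ∈ b) : Occurs b μ σ :=
  ⟨h.ne_nil hm, μ, ψ, List.prefix_refl _, hm⟩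

theorem Interprets.insert_old {f : List ℕ → List ℕ → PointedModel} {b : Set PrefixedFormula}
    (h : Interprets f b) {μ σ : List ℕ} {ψ : RML} (ho : Occurs b μ σ) (hψ : (f μ σ).Holds ψ) :
    Interprets f (insert (μ, σ, ψ) b) where
  ne_nil := by
    rintro _ _ _ (h' | h')
    · simp only [Prod.mk.injEq] at h'
      exact h'.1 ▸ ho.1
    · exact h.ne_nil h'
  holds := by
    rintro _ _ _ (h' | h')
    · simp only [Prod.mk.injEq] at h'
      obtain ⟨rfl, rfl, rfl⟩ := h'
      exact hψ
    · exact h.holds h'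
  refines hμ h' := h.refines hμ (ho.insert_old h')
  step h₁ h₂ := h.step (ho.insert_old h₁) (ho.insert_old h₂)

/-- A diamond witness can be placed at a state prefix none of whose extensions is in use. -/
theorem Interprets.insert_dia {f : List ℕ → List ℕ → PointedModel} {b : Set PrefixedFormula}
    (h : Interprets f b) {μ σ : List ℕ} {ψ : RML} (hm : (μ, σ, .dia ψ) ∈ b) {i : ℕ}
    (hi : ∀ μ' σ' χ, (μ', σ', χ) ∈ b → ¬ σ ++ [i] <+: σ') :
    ∃ g, Interprets g (insert (μ, σ ++ [i], ψ) b) := by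
  obtain ⟨Q, hQ, hψ⟩ := (h.holds hm).dia
  have ho := h.occurs hm
  obtain ⟨g, hgμ, hstep, href⟩ := PointedModel.exists_lift_step (fun κ => f κ σ) μ Q
    (fun κ m hκ hp => h.refines hκ (ho.of_isPrefix (by simp) hp)) hQ
  have hfresh : ∀ {κ τ}, Occurs b κ τ → ¬ σ ++ [i] <+: τ := by
    rintro κ τ ⟨-, κ', χ, -, hmem⟩
    exact hi _ _ _ hmem
  have hne : ∀ {κ τ}, Occurs b κ τ → τ ≠ σ ++ [i] := by
    rintro κ τ ho rfl
    exact hfresh ho (List.prefix_refl _)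
  refine ⟨fun κ τ => if τ = σ ++ [i] then g κ else f κ τ, ?_, ?_, ?_, ?_⟩
  · rintro κ τ χ (h' | h')
    · simp only [Prod.mk.injEq] at h'
      exact h'.1 ▸ ho.1
    · exact h.ne_nil h'
  · rintro κ τ χ (h' | h')
    · simp only [Prod.mk.injEq] at h'
      obtain ⟨rfl, rfl, rfl⟩ := h'
      simpa [hgμ] using hψ
    · simp only [hne (h.occurs h'), if_false]
      exact h.holds h'
  · intro κ m τ hκ h'
    rcases Occurs.insert_iff.mp h' with ⟨-, hp, rfl⟩ | h'
    · simpa using href κ m hκ hp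
    · simp only [hne h', if_false]
      exact h.refines hκ h'
  · intro κ τ j h₁ h₂
    rcases Occurs.insert_iff.mp h₂ with ⟨hκ, hp, he⟩ | h₂
    · have hτ : τ = σ := List.append_inj_left' he rfl
      subst hτ
      simp only [he, if_true]
      simpa using hstep κ hκ hp
    · have h₁' : Occurs b κ τ := by
        rcases Occurs.insert_iff.mp h₁ with ⟨-, -, rfl⟩ | h₁
        · exact absurd (List.prefix_append _ _) (hfresh h₂)
        · exact h₁
      simp only [hne h₁', hne h₂, if_false]
      exact h.step h₁' h₂

/-- A refinement witness can be placed at a model prefix none of whose extensions is in use. -/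
theorem Interprets.insert_ex {f : List ℕ → List ℕ → PointedModel} {b : Set PrefixedFormula}
    (h : Interprets f b) {μ σ : List ℕ} {ψ : RML} (hm : (μ, σ, .ex ψ) ∈ b) {m : ℕ}
    (hfr : ∀ μ' σ' χ, (μ', σ', χ) ∈ b → ¬ μ ++ [m] <+: μ') :
    ∃ g, Interprets g (insert (μ ++ [m], σ, ψ) b) := by
  obtain ⟨Q, hQ, hψ⟩ := (h.holds hm).ex
  have hfresh : ∀ {κ τ}, Occurs b κ τ → ¬ μ ++ [m] <+: κ := by
    rintro κ τ ⟨-, κ', χ, hp, hmem⟩ hp'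
    exact hfr _ _ _ hmem (hp'.trans hp)
  have hne : ∀ {κ τ}, Occurs b κ τ → κ ≠ μ ++ [m] := by
    rintro κ τ ho rfl
    exact hfresh ho (List.prefix_refl _)
  have hcases : ∀ {κ τ}, Occurs (insert (μ ++ [m], σ, ψ) b) κ τ →
      (κ = μ ++ [m] ∧ τ = σ) ∨ Occurs b κ τ := by
    intro κ τ h'
    rcases Occurs.insert_iff.mp h' with ⟨hκ, hp, rfl⟩ | h'
    · rcases List.prefix_concat_iff.mp hp with rfl | hp
      · exact .inl ⟨rfl, rfl⟩
      · exact .inr ((h.occurs hm).of_isPrefix hκ hp)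
    · exact .inr h'
  refine ⟨fun κ τ => if κ = μ ++ [m] then Q else f κ τ, ?_, ?_, ?_, ?_⟩
  · rintro κ τ χ (h' | h')
    · simp only [Prod.mk.injEq] at h'
      rw [h'.1]
      simp
    · exact h.ne_nil h'
  · rintro κ τ χ (h' | h')
    · simp only [Prod.mk.injEq] at h'
      obtain ⟨rfl, rfl, rfl⟩ := h'
      simpa using hψ
    · simp only [hne (h.occurs h'), if_false]
      exact h.holds h'
  · intro κ n τ hκ h'
    rcases hcases h' with ⟨he, rfl⟩ | h'
    · have hκμ : κ = μ := List.append_inj_left' he rfl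
      subst hκμ
      simpa [he] using hQ
    · simp only [hne h', hne (h'.of_isPrefix hκ (List.prefix_append _ _)), if_false]
      exact h.refines hκ h'
  · intro κ τ j h₁ h₂
    rcases hcases h₁ with ⟨rfl, rfl⟩ | h₁'
    · rcases hcases h₂ with ⟨-, he⟩ | h₂
      · simp at he
      · exact absurd (List.prefix_refl _) (hfresh h₂)
    · rcases hcases h₂ with ⟨rfl, -⟩ | h₂
      · exact absurd (List.prefix_refl _) (hfresh h₁')
      · simp only [hne h₁', if_false]
        exact h.step h₁' h₂

/-- The nesting depth of `◇` and `□`. -/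
def modalDepth : RML → ℕ
  | .pos _ => 0
  | .neg _ => 0
  | .and ψ₁ ψ₂ => max (modalDepth ψ₁) (modalDepth ψ₂)
  | .or ψ₁ ψ₂ => max (modalDepth ψ₁) (modalDepth ψ₂)
  | .dia ψ => modalDepth ψ + 1
  | .box ψ => modalDepth ψ + 1
  | .ex ψ => modalDepth ψ

theorem Branch.finite {φ : RML} {b : Set PrefixedFormula} (h : Branch φ b) : b.Finite := by
  induction h <;> simp_all

theorem Branch.depth_le {φ : RML} {b : Set PrefixedFormula} (h : Branch φ b) :
    ∀ x ∈ b, x.2.1.length + modalDepth x.2.2 ≤ modalDepth φ + 1 := by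
  induction h with
  | init => simp [add_comm]
  | andRule _ hm ih | orLeft _ hm ih | orRight _ hm ih | litRule _ hm _ _ _ ih
  | diaRule _ _ hm _ ih | exRule _ _ hm _ ih | boxRule _ hm _ ih =>
    have := ih _ hm
    simp only [modalDepth] at this
    simp only [Set.forall_mem_insert, List.length_append, List.length_singleton]
    refine ⟨by omega, ?_⟩
    first
      | exact ih
      | exact ⟨by omega, ih⟩

theorem exists_fresh {S : Set (List ℕ)} (hS : S.Finite) (σ : List ℕ) :
    ∃ i, ∀ l ∈ S, ¬ σ ++ [i] <+: l := by
  obtain ⟨i, hi⟩ := (hS.image fun l => l.getD σ.length 0).exists_notMem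
  refine ⟨i, fun l hl hp => hi ⟨l, hl, ?_⟩⟩
  obtain ⟨t, rfl⟩ := hp
  simp

/-- The box rule has been applied exhaustively to box formulas at states of length below `k`. -/
def BoxClosedBelow (k : ℕ) (b : Set PrefixedFormula) : Prop :=
  ∀ μ σ i ψ, σ.length < k → (μ, σ, .box ψ) ∈ b → Occurs b μ (σ ++ [i]) → (μ, σ ++ [i], ψ) ∈ b

/-- Branches with an interpretation, closed under the box rule below level `k`. -/
structure Good (φ : RML) (k : ℕ) (b : Set PrefixedFormula) : Prop where
  branch : Branch φ b
  interp : ∃ f, Interprets f b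
  box : BoxClosedBelow k b

theorem BoxClosedBelow.insert_old {k : ℕ} {b : Set PrefixedFormula} (h : BoxClosedBelow k b)
    {μ σ : List ℕ} {ψ : RML} (hk : k ≤ σ.length) (ho : Occurs b μ σ) :
    BoxClosedBelow k (insert (μ, σ, ψ) b) := by
  rintro κ τ i χ hτ (h' | h') h''
  · simp only [Prod.mk.injEq] at h'
    obtain ⟨-, rfl, -⟩ := h'
    omega
  · exact .inr (h κ τ i χ hτ h' (ho.insert_old h''))

namespace Good

variable {φ : RML} {k : ℕ} {b : Set PrefixedFormula}

theorem ne_nil (h : Good φ k b) {μ σ : List ℕ} {ψ : RML} (hm : (μ, σ, ψ) ∈ b) : μ ≠ [] := by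
  obtain ⟨f, hf⟩ := h.interp
  exact hf.ne_nil hm

theorem occurs (h : Good φ k b) {μ σ : List ℕ} {ψ : RML} (hm : (μ, σ, ψ) ∈ b) :
    Occurs b μ σ :=
  ⟨h.ne_nil hm, μ, ψ, List.prefix_refl _, hm⟩

theorem and (h : Good φ k b) {μ σ : List ℕ} {ψ₁ ψ₂ : RML} (hk : k ≤ σ.length)
    (hm : (μ, σ, .and ψ₁ ψ₂) ∈ b) : Good φ k (insert (μ, σ, ψ₁) (insert (μ, σ, ψ₂) b)) := by
  obtain ⟨f, hf⟩ := h.interp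
  have ho := hf.occurs hm
  have ho' : Occurs (insert (μ, σ, ψ₂) b) μ σ := Occurs.insert_iff.mpr (.inr ho)
  have hs := hf.holds hm
  exact ⟨h.branch.andRule hm, ⟨f, (hf.insert_old ho hs.2).insert_old ho' hs.1⟩,
    (h.box.insert_old hk ho).insert_old hk ho'⟩

theorem or (h : Good φ k b) {μ σ : List ℕ} {ψ₁ ψ₂ : RML} (hk : k ≤ σ.length)
    (hm : (μ, σ, .or ψ₁ ψ₂) ∈ b) :
    Good φ k (insert (μ, σ, ψ₁) b) ∨ Good φ k (insert (μ, σ, ψ₂) b) := by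
  obtain ⟨f, hf⟩ := h.interp
  have ho := hf.occurs hm
  rcases hf.holds hm with hs | hs
  · exact .inl ⟨h.branch.orLeft hm, ⟨f, hf.insert_old ho hs⟩, h.box.insert_old hk ho⟩
  · exact .inr ⟨h.branch.orRight hm, ⟨f, hf.insert_old ho hs⟩, h.box.insert_old hk ho⟩

theorem lit (h : Good φ k b) {μ σ : List ℕ} {m : ℕ} {l : RML} (hk : k ≤ σ.length)
    (hm : (μ ++ [m], σ, l) ∈ b) (hl : IsLiteral l) (hμ : μ ≠ []) :
    Good φ k (insert (μ, σ, l) b) := by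
  obtain ⟨f, hf⟩ := h.interp
  have ho' := hf.occurs hm
  have ho : Occurs b μ σ := ho'.of_isPrefix hμ (List.prefix_append _ _)
  exact ⟨h.branch.litRule hm hl hμ (by simp),
    ⟨f, hf.insert_old ho ((hf.refines hμ ho').literal hl (hf.holds hm))⟩,
    h.box.insert_old hk ho⟩

theorem boxStep (h : Good φ k b) {μ σ : List ℕ} {i : ℕ} {ψ : RML} (hk : k ≤ σ.length)
    (hm : (μ, σ, .box ψ) ∈ b) (ho : Occurs b μ (σ ++ [i])) :
    Good φ k (insert (μ, σ ++ [i], ψ) b) := by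
  obtain ⟨f, hf⟩ := h.interp
  have ho' := hf.occurs hm
  obtain ⟨-, _, χ, ⟨ν, rfl⟩, hχ⟩ := id ho
  exact ⟨h.branch.boxRule hm hχ, ⟨f, hf.insert_old ho ((hf.step ho' ho).box (hf.holds hm))⟩,
    h.box.insert_old (by simp; omega) ho⟩

theorem dia (h : Good φ k b) {μ σ : List ℕ} {ψ : RML} (hk : k ≤ σ.length)
    (hm : (μ, σ, .dia ψ) ∈ b) : ∃ i, Good φ k (insert (μ, σ ++ [i], ψ) b) := by
  obtain ⟨f, hf⟩ := h.interp
  obtain ⟨i, hi⟩ := exists_fresh (h.branch.finite.image fun x => x.2.1) σ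
  have hi' : ∀ μ' σ' χ, (μ', σ', χ) ∈ b → ¬ σ ++ [i] <+: σ' :=
    fun μ' σ' χ hmem => hi σ' ⟨_, hmem, rfl⟩
  refine ⟨i, h.branch.diaRule i hm fun μ' χ hmem => hi' _ _ _ hmem (List.prefix_refl _),
    hf.insert_dia hm hi', ?_⟩
  rintro κ τ j χ hτ (h' | h') h''
  · simp only [Prod.mk.injEq] at h'
    obtain ⟨-, rfl, -⟩ := h'
    simp only [List.length_append, List.length_singleton] at hτ
    omega
  · rcases Occurs.insert_iff.mp h'' with ⟨-, -, he⟩ | h''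
    · obtain rfl := List.append_inj_left' he rfl
      omega
    · exact .inr (h.box κ τ j χ hτ h' h'')

theorem ex (h : Good φ k b) {μ σ : List ℕ} {ψ : RML} (hk : k ≤ σ.length)
    (hm : (μ, σ, .ex ψ) ∈ b) : ∃ m, Good φ k (insert (μ ++ [m], σ, ψ) b) := by
  obtain ⟨f, hf⟩ := h.interp
  obtain ⟨m, hi⟩ := exists_fresh (h.branch.finite.image fun x => x.1) μ
  have hi' : ∀ μ' σ' χ, (μ', σ', χ) ∈ b → ¬ μ ++ [m] <+: μ' :=
    fun μ' σ' χ hmem => hi μ' ⟨_, hmem, rfl⟩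
  refine ⟨m, h.branch.exRule m hm fun σ' χ hmem => hi' _ _ _ hmem (List.prefix_refl _),
    hf.insert_ex hm hi', ?_⟩
  rintro κ τ j χ hτ (h' | h') h''
  · simp only [Prod.mk.injEq] at h'
    obtain ⟨-, rfl, -⟩ := h'
    omega
  · refine .inr (h.box κ τ j χ hτ h' ?_)
    rcases Occurs.insert_iff.mp h'' with ⟨hκ, hp, he⟩ | h''
    · rcases List.prefix_concat_iff.mp hp with rfl | hp
      · exact absurd (List.prefix_refl _) (hi' _ _ _ h')
      · rw [he]
        exact (hf.occurs hm).of_isPrefix hκ hp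
    · exact h''

end Good

/-- `b'` extends `b` by prefixed formulas satisfying `A b'`. -/
def Extends (A : Set PrefixedFormula → PrefixedFormula → Prop) (b b' : Set PrefixedFormula) :
    Prop :=
  b ⊆ b' ∧ ∀ x ∈ b', x ∈ b ∨ A b' x

theorem Extends.refl {A : Set PrefixedFormula → PrefixedFormula → Prop}
    (b : Set PrefixedFormula) : Extends A b b :=
  ⟨subset_rfl, fun _ h => .inl h⟩

theorem Extends.trans {A : Set PrefixedFormula → PrefixedFormula → Prop}
    (hA : ∀ x, Monotone fun b => A b x) {b b' b'' : Set PrefixedFormula}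
    (h : Extends A b b') (h' : Extends A b' b'') : Extends A b b'' := by
  refine ⟨h.1.trans h'.1, fun x hx => ?_⟩
  rcases h'.2 x hx with hx | hx
  · exact (h.2 x hx).imp_right (hA x h'.1)
  · exact .inr hx

theorem Extends.of_insert {A : Set PrefixedFormula → PrefixedFormula → Prop}
    {b b' : Set PrefixedFormula} {x : PrefixedFormula} (h : Extends A (insert x b) b')
    (hx : A b' x) : Extends A b b' := by
  refine ⟨(Set.subset_insert _ _).trans h.1, fun y hy => ?_⟩
  rcases h.2 y hy with (rfl | hy) | hy
  · exact .inr hx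
  · exact .inl hy
  · exact .inr hy

/-- Finitely many monotone tasks, each achievable by a good extension, are jointly achievable. -/
theorem exists_extends_forall {ι : Type} {G : Set PrefixedFormula → Prop}
    {A : Set PrefixedFormula → PrefixedFormula → Prop} (hA : ∀ x, Monotone fun b => A b x)
    {D : ι → Set PrefixedFormula → Prop} (hD : ∀ t, Monotone (D t)) {S : Set ι}
    (hS : S.Finite) {b : Set PrefixedFormula} (hb : G b)
    (h : ∀ t ∈ S, ∀ c, b ⊆ c → G c → ∃ c', G c' ∧ Extends A c c' ∧ D t c') :
    ∃ b', G b' ∧ Extends A b b' ∧ ∀ t ∈ S, D t b' := by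
  induction S, hS using Set.Finite.induction_on with
  | empty => exact ⟨b, hb, .refl b, by simp⟩
  | insert _ _ ih =>
    obtain ⟨c, hc, hbc, hDc⟩ := ih fun t ht => h t (.inr ht)
    obtain ⟨c', hc', hcc', hDc'⟩ := h _ (.inl rfl) c hbc.1 hc
    refine ⟨c', hc', hbc.trans hA hcc', ?_⟩
    rintro t (rfl | ht)
    · exact hDc'
    · exact hD t hcc'.1 (hDc t ht)

/-- All rules that do not change the state prefix have been applied to the given formula. -/
def LocallyDone (b : Set PrefixedFormula) (μ σ : List ℕ) : RML → Prop
  | .and ψ₁ ψ₂ => (μ, σ, ψ₁) ∈ b ∧ (μ, σ, ψ₂) ∈ b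
  | .or ψ₁ ψ₂ => (μ, σ, ψ₁) ∈ b ∨ (μ, σ, ψ₂) ∈ b
  | .ex ψ => ∃ m, (μ ++ [m], σ, ψ) ∈ b
  | .pos p => ∀ κ, κ ≠ [] → κ <+: μ → (κ, σ, .pos p) ∈ b
  | .neg p => ∀ κ, κ ≠ [] → κ <+: μ → (κ, σ, .neg p) ∈ b
  | .dia _ => True
  | .box _ => True

theorem LocallyDone.mono {b b' : Set PrefixedFormula} (hb : b ⊆ b') {μ σ : List ℕ} {ψ : RML}
    (h : LocallyDone b μ σ ψ) : LocallyDone b' μ σ ψ := by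
  cases ψ with
  | pos | neg => exact fun κ h₁ h₂ => hb (h κ h₁ h₂)
  | and => exact ⟨hb h.1, hb h.2⟩
  | or => exact h.imp (@hb _) (@hb _)
  | dia | box => trivial
  | ex => exact h.imp fun _ h => hb h

theorem locallyDone_literal {b : Set PrefixedFormula} {μ σ : List ℕ} {l : RML}
    (hl : IsLiteral l) :
    LocallyDone b μ σ l ↔ ∀ κ, κ ≠ [] → κ <+: μ → (κ, σ, l) ∈ b := by
  cases l <;> first | rfl | exact hl.elim

/-- The formulas that may be added when saturating level `k` under the local rules. -/
def LocalAt (k : ℕ) (b : Set PrefixedFormula) (x : PrefixedFormula) : Prop :=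
  x.2.1.length = k ∧ LocallyDone b x.1 x.2.1 x.2.2

theorem localAt_mono (k : ℕ) (x : PrefixedFormula) : Monotone fun b => LocalAt k b x :=
  fun _ _ hb h => ⟨h.1, h.2.mono hb⟩

theorem exists_extends_literal {φ l : RML} {k : ℕ} (hl : IsLiteral l) {σ : List ℕ}
    (hσ : σ.length = k) (μ : List ℕ) (b : Set PrefixedFormula) (hb : Good φ k b)
    (hm : (μ, σ, l) ∈ b) :
    ∃ b', Good φ k b' ∧ Extends (LocalAt k) b b' ∧ LocallyDone b' μ σ l := by
  induction μ using List.reverseRecOn generalizing b with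
  | nil => exact absurd rfl (hb.ne_nil hm)
  | append_singleton μ m ih =>
    by_cases hμ : μ = []
    · subst hμ
      refine ⟨b, hb, .refl b, (locallyDone_literal hl).mpr fun κ hκ hp => ?_⟩
      rcases List.prefix_concat_iff.mp hp with rfl | hp
      · exact hm
      · exact absurd (List.prefix_nil.mp hp) hκ
    · obtain ⟨b', hb', he, hd⟩ := ih _ (hb.lit hσ.ge hm hl hμ) (.inl rfl)
      have he' : Extends (LocalAt k) b b' := he.of_insert ⟨hσ, hd⟩
      refine ⟨b', hb', he', (locallyDone_literal hl).mpr fun κ hκ hp => ?_⟩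
      rcases List.prefix_concat_iff.mp hp with rfl | hp
      · exact he'.1 hm
      · exact (locallyDone_literal hl).mp hd κ hκ hp

theorem exists_extends_locallyDone {φ : RML} {k : ℕ} {σ : List ℕ} (hσ : σ.length = k)
    (ψ : RML) (μ : List ℕ) (b : Set PrefixedFormula) (hb : Good φ k b) (hm : (μ, σ, ψ) ∈ b) :
    ∃ b', Good φ k b' ∧ Extends (LocalAt k) b b' ∧ LocallyDone b' μ σ ψ := by
  induction ψ generalizing μ b with
  | pos p => exact exists_extends_literal (by trivial) hσ μ b hb hm
  | neg p => exact exists_extends_literal (by trivial) hσ μ b hb hm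
  | dia | box => exact ⟨b, hb, .refl b, trivial⟩
  | and ψ₁ ψ₂ ih₁ ih₂ =>
    obtain ⟨c, hc, hec, hdc⟩ := ih₁ μ _ (hb.and hσ.ge hm) (.inl rfl)
    obtain ⟨d, hd, hed, hdd⟩ := ih₂ μ c hc (hec.1 (.inr (.inl rfl)))
    have he := hec.trans (localAt_mono k) hed
    refine ⟨d, hd, ?_, he.1 (.inl rfl), he.1 (.inr (.inl rfl))⟩
    exact (he.of_insert ⟨hσ, hdc.mono hed.1⟩).of_insert ⟨hσ, hdd⟩
  | or ψ₁ ψ₂ ih₁ ih₂ =>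
    rcases hb.or hσ.ge hm with hg | hg
    · obtain ⟨c, hc, hec, hdc⟩ := ih₁ μ _ hg (.inl rfl)
      exact ⟨c, hc, hec.of_insert ⟨hσ, hdc⟩, .inl (hec.1 (.inl rfl))⟩
    · obtain ⟨c, hc, hec, hdc⟩ := ih₂ μ _ hg (.inl rfl)
      exact ⟨c, hc, hec.of_insert ⟨hσ, hdc⟩, .inr (hec.1 (.inl rfl))⟩
  | ex ψ ih =>
    obtain ⟨m, hg⟩ := hb.ex hσ.ge hm
    obtain ⟨c, hc, hec, hdc⟩ := ih (μ ++ [m]) _ hg (.inl rfl)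
    exact ⟨c, hc, hec.of_insert ⟨hσ, hdc⟩, m, hec.1 (.inl rfl)⟩

/-- The local rules and the diamond rule have been applied exhaustively below level `k`. -/
def DoneBelow (k : ℕ) (b : Set PrefixedFormula) : Prop :=
  ∀ μ σ ψ, (μ, σ, ψ) ∈ b → σ.length < k →
    LocallyDone b μ σ ψ ∧ ∀ χ, ψ = .dia χ → ∃ i, (μ, σ ++ [i], χ) ∈ b

theorem exists_locally_done_level {φ : RML} {k : ℕ} {b : Set PrefixedFormula}
    (hb : Good φ k b) :
    ∃ b', Good φ k b' ∧ Extends (LocalAt k) b b' ∧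
      ∀ μ σ ψ, (μ, σ, ψ) ∈ b' → σ.length = k → LocallyDone b' μ σ ψ := by
  obtain ⟨c, hc, he, hd⟩ := exists_extends_forall (G := Good φ k) (localAt_mono k)
    (D := fun (x : PrefixedFormula) c => x.2.1.length = k → LocallyDone c x.1 x.2.1 x.2.2)
    (fun x _ _ hcc h hx => (h hx).mono hcc) hb.branch.finite hb (by
      rintro ⟨μ, σ, ψ⟩ hx c hbc hc
      by_cases hσ : σ.length = k
      · obtain ⟨c', h₁, h₂, h₃⟩ := exists_extends_locallyDone hσ ψ μ c hc (hbc hx)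
        exact ⟨c', h₁, h₂, fun _ => h₃⟩
      · exact ⟨c, hc, .refl c, fun h => absurd h hσ⟩)
  refine ⟨c, hc, he, fun μ σ ψ hm hσ => ?_⟩
  rcases he.2 _ hm with h | h
  · exact hd _ h hσ
  · exact h.2

theorem exists_dia_done_level {φ : RML} {k : ℕ} {b : Set PrefixedFormula} (hb : Good φ k b) :
    ∃ b', Good φ k b' ∧ Extends (fun _ x => x.2.1.length = k + 1) b b' ∧
      ∀ μ σ ψ, (μ, σ, .dia ψ) ∈ b → σ.length = k → ∃ i, (μ, σ ++ [i], ψ) ∈ b' := by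
  obtain ⟨c, hc, he, hd⟩ := exists_extends_forall (G := Good φ k)
    (A := fun _ x => x.2.1.length = k + 1) (fun x _ _ _ h => h)
    (D := fun (x : PrefixedFormula) c => ∀ ψ, x.2.2 = .dia ψ → x.2.1.length = k →
      ∃ i, (x.1, x.2.1 ++ [i], ψ) ∈ c)
    (fun x _ _ hcc h ψ h₁ h₂ => (h ψ h₁ h₂).imp fun _ h => hcc h) hb.branch.finite hb (by
      rintro ⟨μ, σ, ψ⟩ hx c hbc hc
      by_cases hσ : σ.length = k ∧ ∃ χ, ψ = .dia χ
      · obtain ⟨hσ, χ, rfl⟩ := hσ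
        obtain ⟨i, hg⟩ := hc.dia hσ.ge (hbc hx)
        refine ⟨_, hg, (Extends.refl _).of_insert (by simp [hσ]), fun χ' hχ _ => ⟨i, ?_⟩⟩
        cases hχ
        exact .inl rfl
      · exact ⟨c, hc, .refl c, fun χ h h' => absurd ⟨h', χ, h⟩ hσ⟩)
  exact ⟨c, hc, he, fun μ σ ψ hm hσ => hd _ hm ψ rfl hσ⟩

theorem exists_box_done_level {φ : RML} {k : ℕ} {b : Set PrefixedFormula} (hb : Good φ k b) :
    ∃ b', Good φ (k + 1) b' ∧ Extends (fun _ x => x.2.1.length = k + 1) b b' := by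
  obtain ⟨c, hc, he, hd⟩ := exists_extends_forall (G := Good φ k)
    (A := fun _ x => x.2.1.length = k + 1 ∧ Occurs b x.1 x.2.1) (fun x _ _ _ h => h)
    (D := fun (x : PrefixedFormula × PrefixedFormula) c => ∀ ψ i, x.1.2.2 = .box ψ →
      x.1.2.1.length = k → x.1.1 <+: x.2.1 → x.2.2.1 = x.1.2.1 ++ [i] →
      (x.1.1, x.2.2.1, ψ) ∈ c)
    (fun x _ _ hcc h ψ i h₁ h₂ h₃ h₄ => hcc (h ψ i h₁ h₂ h₃ h₄))
    (hb.branch.finite.prod hb.branch.finite) hb (by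
      rintro ⟨⟨μ, σ, ψ⟩, ⟨κ, τ, χ⟩⟩ ⟨hx, hy⟩ c hbc hc
      by_cases hσ : σ.length = k ∧ (∃ χ, ψ = .box χ) ∧ μ <+: κ ∧ ∃ i, τ = σ ++ [i]
      · obtain ⟨hσ, ⟨χ', rfl⟩, hp, i, rfl⟩ := hσ
        have hμ := hb.ne_nil hx
        refine ⟨_, hc.boxStep (i := i) hσ.ge (hbc hx) ⟨hμ, κ, χ, hp, hbc hy⟩,
          (Extends.refl _).of_insert ⟨by simp [hσ], hμ, κ, χ, hp, hy⟩, fun ψ' j h _ _ _ => ?_⟩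
        cases h
        exact .inl rfl
      · exact ⟨c, hc, .refl c, fun ψ' i h₁ h₂ h₃ h₄ => absurd ⟨h₂, ⟨_, h₁⟩, h₃, _, h₄⟩ hσ⟩)
  refine ⟨c, ⟨hc.branch, hc.interp, fun μ σ i ψ hσ hm ho => ?_⟩,
    he.1, fun x hx => (he.2 x hx).imp_right And.left⟩
  rcases Nat.lt_succ_iff_lt_or_eq.mp hσ with hσ | hσ
  · exact hc.box μ σ i ψ hσ hm ho
  · have hm' : (μ, σ, .box ψ) ∈ b := by
      rcases he.2 _ hm with h | ⟨h, -⟩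
      · exact h
      · simp only at h
        omega
    obtain ⟨hμ, κ, χ, hp, hκ⟩ := ho
    have ho' : Occurs b κ (σ ++ [i]) := by
      rcases he.2 _ hκ with h | ⟨-, h⟩
      · exact hb.occurs h
      · exact h
    obtain ⟨-, κ', χ', hp', hκ'⟩ := ho'
    exact hd ((μ, σ, .box ψ), (κ', σ ++ [i], χ')) ⟨hm', hκ'⟩ ψ i rfl hσ (hp.trans hp') rfl

theorem exists_done_succ {φ : RML} {k : ℕ} {b : Set PrefixedFormula} (hb : Good φ k b)
    (hd : DoneBelow k b) : ∃ b', Good φ (k + 1) b' ∧ DoneBelow (k + 1) b' := by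
  obtain ⟨c, hc, hec, hlc⟩ := exists_locally_done_level hb
  obtain ⟨d, hgd, hed, hdd⟩ := exists_dia_done_level hc
  obtain ⟨e, hge, hee⟩ := exists_box_done_level hgd
  refine ⟨e, hge, fun μ σ ψ hm hσ => ?_⟩
  have hmc : (μ, σ, ψ) ∈ c := by
    rcases hee.2 _ hm with h | h
    · rcases hed.2 _ h with h | h
      · exact h
      · simp only at h
        omega
    · simp only at h
      omega
  have hce := hed.1.trans hee.1
  rcases Nat.lt_succ_iff_lt_or_eq.mp hσ with hσ | hσ
  · have hmb : (μ, σ, ψ) ∈ b := by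
      rcases hec.2 _ hmc with h | ⟨h, -⟩
      · exact h
      · simp only at h
        omega
    obtain ⟨h₁, h₂⟩ := hd μ σ ψ hmb hσ
    have hbe := hec.1.trans hce
    exact ⟨h₁.mono hbe, fun χ hχ => (h₂ χ hχ).imp fun _ h => hbe h⟩
  · refine ⟨(hlc μ σ ψ hmc hσ).mono hce, ?_⟩
    rintro χ rfl
    exact (hdd μ σ χ hmc hσ).imp fun _ h => hee.1 h

theorem exists_done {φ : RML} (h : Satisfiable φ) (k : ℕ) :
    ∃ b, Good φ k b ∧ DoneBelow k b := by
  induction k with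
  | zero =>
    obtain ⟨W, M, s, hs⟩ := h
    refine ⟨_, ⟨.init, ⟨fun _ _ => ⟨M, s⟩, ?_, ?_, ?_, ?_⟩, ?_⟩, ?_⟩
    · intro μ σ ψ hm
      simp only [Set.mem_singleton_iff, Prod.mk.injEq] at hm
      simp [hm.1]
    · intro μ σ ψ hm
      simp only [Set.mem_singleton_iff, Prod.mk.injEq] at hm
      rw [hm.2.2]
      exact hs
    · rintro μ m σ hμ ⟨-, κ, χ, hp, hm⟩
      simp only [Set.mem_singleton_iff, Prod.mk.injEq] at hm
      have := hp.length_le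
      rw [hm.1] at this
      simp only [List.length_append, List.length_singleton] at this
      exact absurd (List.length_eq_zero_iff.mp (by omega)) hμ
    · rintro μ σ i ⟨-, κ, χ, -, hm⟩ ⟨-, κ', χ', -, hm'⟩
      simp only [Set.mem_singleton_iff, Prod.mk.injEq] at hm hm'
      have := hm'.2.1
      rw [hm.2.1] at this
      simp at this
    · intro μ σ i ψ hσ
      omega
    · intro μ σ ψ _ hσ
      omega
  | succ k ih =>
    obtain ⟨b, hb, hd⟩ := ih
    exact exists_done_succ hb hd

/-- If an RML^∃ formula `φ` is satisfiable, then there exists a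
complete accepting tableau branch for `φ` (starting from `(1,1) φ`). -/
theorem satisfiable_implies_complete_accepting_branch (φ : RML)
    (h : Satisfiable φ) :
    ∃ b : Set PrefixedFormula, Branch φ b ∧ Complete b ∧ Accepting b := by
  obtain ⟨b, hb, hd⟩ := exists_done h (modalDepth φ + 2)
  have hlt : ∀ {μ σ ψ}, (μ, σ, ψ) ∈ b → σ.length < modalDepth φ + 2 := by
    intro μ σ ψ hm
    have := hb.branch.depth_le _ hm
    simp only at this
    omega
  have hloc : ∀ {μ σ ψ}, (μ, σ, ψ) ∈ b → LocallyDone b μ σ ψ :=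
    fun hm => (hd _ _ _ hm (hlt hm)).1
  refine ⟨b, hb.branch, ⟨?_, ?_, ?_, ?_, ?_, ?_⟩, ?_⟩
  · exact fun μ σ ψ₁ ψ₂ hm => hloc hm
  · exact fun μ σ ψ₁ ψ₂ hm => hloc hm
  · exact fun μ ν σ l hl hμ _ hm =>
      (locallyDone_literal hl).mp (hloc hm) μ hμ (List.prefix_append _ _)
  · exact fun μ σ ψ hm => (hd _ _ _ hm (hlt hm)).2 ψ rfl
  · exact fun μ σ ψ hm => hloc hm
  · exact fun μ ν σ i ψ χ hm hχ => hb.box μ σ i ψ (hlt hm) hm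
      ⟨hb.ne_nil hm, μ ++ ν, χ, List.prefix_append _ _, hχ⟩
  · rintro ⟨μ, σ, p, hp, hn⟩
    obtain ⟨f, hf⟩ := hb.interp
    exact hf.holds hn (hf.holds hp)
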